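/- For every countable ordinal ξ with 1 ≤ ξ < ω₁, there exists a set A ⊆ 2^{<ω} such that the ω-power A^∞ is Π^0_ξ-complete; in particular A^∞ ∈ Π^0_ξ(2^ω) \ Σ^0_ξ(2^ω). -/

import Mathlib

open Topology MeasureTheory TopologicalSpace

abbrev Cantor : Type := ℕ → Fin 2

/-- The concatenation of the first `m` words of the sequence `a`. -/
def concatPrefix {β : Type*} (a : ℕ → List β) (m : ℕ) : List β :=
  ((List.range m).map a).flatten

/-- The ω-power of a set `A` of finite words: the set of all infinite words obtained by
concatenating a sequence of words of `A` (infinitely many of them being nonempty). -/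
def omegaPower {β : Type*} (A : Set (List β)) : Set (ℕ → β) :=
  {α | ∃ a : ℕ → List β, (∀ i, a i ∈ A) ∧
    (∀ n, ∃ m, n ≤ (concatPrefix a m).length) ∧
    ∀ (m k : ℕ) (h : k < (concatPrefix a m).length), (concatPrefix a m).get ⟨k, h⟩ = α k}

/-- The Borel class Σ⁰_ξ of a topological space: Σ⁰_ξ is the class of open sets for ξ ≤ 1,
and for ξ ≥ 2 it consists of the countable unions of sets each lying in some Π⁰_η
with 1 ≤ η < ξ. -/
noncomputable def SigmaZero (X : Type*) [TopologicalSpace X] (ξ : Ordinal.{0}) : Set (Set X) :=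
  if ξ ≤ 1 then {s | IsOpen s}
  else {s | ∃ f : ℕ → Set X,
    (∀ n, ∃ η : Ordinal.{0}, ∃ _ : 1 ≤ η, ∃ _ : η < ξ, (f n)ᶜ ∈ SigmaZero X η) ∧
    s = ⋃ n, f n}
termination_by ξ

/-- The Borel class Π⁰_ξ: complements of Σ⁰_ξ sets. -/
noncomputable def PiZero (X : Type*) [TopologicalSpace X] (ξ : Ordinal.{0}) : Set (Set X) :=
  {s | sᶜ ∈ SigmaZero X ξ}

/-- A topological space is zero-dimensional if it has a basis consisting of clopen sets. -/
def ZeroDim (X : Type*) [TopologicalSpace X] : Prop :=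
  ∃ b : Set (Set X), IsTopologicalBasis b ∧ ∀ s ∈ b, IsClopen s

/-! ### Closure properties of the Borel classes -/

section BorelClasses

variable {X : Type*} [TopologicalSpace X]

theorem sigmaZero_one : SigmaZero X 1 = {s | IsOpen s} := by
  rw [SigmaZero, if_pos le_rfl]

theorem mem_sigmaZero_iff {ξ : Ordinal.{0}} (h : 1 < ξ) {s : Set X} :
    s ∈ SigmaZero X ξ ↔ ∃ f : ℕ → Set X,
      (∀ n, ∃ η : Ordinal.{0}, 1 ≤ η ∧ η < ξ ∧ f n ∈ PiZero X η) ∧ s = ⋃ n, f n := by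
  rw [SigmaZero, if_neg (not_le.2 h)]
  simp [PiZero, and_left_comm]

theorem mem_piZero_iff {ξ : Ordinal.{0}} {s : Set X} :
    s ∈ PiZero X ξ ↔ sᶜ ∈ SigmaZero X ξ :=
  Iff.rfl

theorem mem_piZero_one {s : Set X} : s ∈ PiZero X 1 ↔ IsClosed s := by
  simp [PiZero, sigmaZero_one]

theorem compl_mem_piZero {ξ : Ordinal.{0}} {s : Set X} :
    sᶜ ∈ PiZero X ξ ↔ s ∈ SigmaZero X ξ := by
  simp [PiZero]

theorem piZero_subset_sigmaZero {η ξ : Ordinal.{0}} (hη : 1 ≤ η) (h : η < ξ) {s : Set X}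
    (hs : s ∈ PiZero X η) : s ∈ SigmaZero X ξ :=
  (mem_sigmaZero_iff (hη.trans_lt h)).2
    ⟨fun _ => s, fun _ => ⟨η, hη, h, hs⟩, (Set.iUnion_const s).symm⟩

theorem IsClosed.mem_sigmaZero {ξ : Ordinal.{0}} (h : 1 < ξ) {s : Set X} (hs : IsClosed s) :
    s ∈ SigmaZero X ξ :=
  piZero_subset_sigmaZero le_rfl h (mem_piZero_one.2 hs)

theorem iUnion_mem_sigmaZero {ι : Type*} [Countable ι] {ξ : Ordinal.{0}} (hξ : 1 ≤ ξ)
    {s : ι → Set X} (hs : ∀ i, s i ∈ SigmaZero X ξ) : ⋃ i, s i ∈ SigmaZero X ξ := by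
  rcases hξ.eq_or_lt with rfl | h
  · rw [sigmaZero_one] at *
    exact isOpen_iUnion hs
  rcases isEmpty_or_nonempty ι with _ | _
  · rw [Set.iUnion_of_empty]
    exact isClosed_empty.mem_sigmaZero h
  obtain ⟨e, he⟩ := exists_surjective_nat ι
  choose f hf hs using fun i => (mem_sigmaZero_iff h).1 (hs i)
  refine (mem_sigmaZero_iff h).2 ⟨fun n => f (e n.unpair.1) n.unpair.2, fun n => hf _ _, ?_⟩
  ext x
  simp only [hs, Set.mem_iUnion]
  constructor
  · rintro ⟨i, j, hx⟩
    obtain ⟨k, rfl⟩ := he i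
    exact ⟨Nat.pair k j, by simpa using hx⟩
  · rintro ⟨n, hx⟩
    exact ⟨_, _, hx⟩

theorem union_mem_sigmaZero {ξ : Ordinal.{0}} (hξ : 1 ≤ ξ) {s t : Set X}
    (hs : s ∈ SigmaZero X ξ) (ht : t ∈ SigmaZero X ξ) : s ∪ t ∈ SigmaZero X ξ := by
  rw [Set.union_eq_iUnion]
  exact iUnion_mem_sigmaZero hξ (by rintro (_ | _) <;> assumption)

theorem iInter_mem_piZero {ι : Type*} [Countable ι] {ξ : Ordinal.{0}} (hξ : 1 ≤ ξ)
    {s : ι → Set X} (hs : ∀ i, s i ∈ PiZero X ξ) : ⋂ i, s i ∈ PiZero X ξ := by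
  rw [mem_piZero_iff, Set.compl_iInter]
  exact iUnion_mem_sigmaZero hξ hs

theorem preimage_mem_sigmaZero {Y : Type*} [TopologicalSpace Y] {f : X → Y} (hf : Continuous f)
    {ξ : Ordinal.{0}} (hξ : 1 ≤ ξ) {s : Set Y} (hs : s ∈ SigmaZero Y ξ) :
    f ⁻¹' s ∈ SigmaZero X ξ := by
  induction ξ using WellFoundedLT.induction generalizing s with
  | _ ξ ih =>
    rcases hξ.eq_or_lt with rfl | h
    · rw [sigmaZero_one] at *
      exact hs.preimage hf
    obtain ⟨g, hg, rfl⟩ := (mem_sigmaZero_iff h).1 hs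
    refine (mem_sigmaZero_iff h).2 ⟨fun n => f ⁻¹' g n, fun n => ?_, Set.preimage_iUnion⟩
    obtain ⟨η, h1, h2, h3⟩ := hg n
    exact ⟨η, h1, h2, ih η h2 h1 h3⟩

theorem preimage_mem_piZero {Y : Type*} [TopologicalSpace Y] {f : X → Y} (hf : Continuous f)
    {ξ : Ordinal.{0}} (hξ : 1 ≤ ξ) {s : Set Y} (hs : s ∈ PiZero Y ξ) :
    f ⁻¹' s ∈ PiZero X ξ :=
  preimage_mem_sigmaZero hf hξ hs

theorem empty_mem_piZero {ξ : Ordinal.{0}} (hξ : 1 ≤ ξ) : (∅ : Set X) ∈ PiZero X ξ := by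
  rw [mem_piZero_iff, Set.compl_empty]
  rcases hξ.eq_or_lt with rfl | h
  · simp [sigmaZero_one]
  · exact isClosed_univ.mem_sigmaZero h

theorem inter_mem_piZero {ξ : Ordinal.{0}} (hξ : 1 ≤ ξ) {s t : Set X}
    (hs : s ∈ PiZero X ξ) (ht : t ∈ PiZero X ξ) : s ∩ t ∈ PiZero X ξ := by
  rw [mem_piZero_iff, Set.compl_inter]
  exact union_mem_sigmaZero hξ hs ht

variable [MetrizableSpace X]

theorem IsOpen.mem_sigmaZero {ξ : Ordinal.{0}} (hξ : 1 ≤ ξ) {s : Set X} (hs : IsOpen s) :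
    s ∈ SigmaZero X ξ := by
  rcases hξ.eq_or_lt with rfl | h
  · rwa [sigmaZero_one]
  let := metrizableSpaceMetric X
  obtain ⟨F, hF, -, rfl, -⟩ := hs.exists_iUnion_isClosed
  exact iUnion_mem_sigmaZero hξ fun n => (hF n).mem_sigmaZero h

theorem IsClosed.mem_piZero {ξ : Ordinal.{0}} (hξ : 1 ≤ ξ) {s : Set X} (hs : IsClosed s) :
    s ∈ PiZero X ξ :=
  hs.isOpen_compl.mem_sigmaZero hξ

theorem sigmaZero_mono {η ξ : Ordinal.{0}} (hη : 1 ≤ η) (h : η ≤ ξ) :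
    SigmaZero X η ⊆ SigmaZero X ξ := by
  intro s hs
  rcases hη.eq_or_lt with rfl | h1
  · rw [sigmaZero_one] at hs
    exact hs.mem_sigmaZero h
  obtain ⟨f, hf, rfl⟩ := (mem_sigmaZero_iff h1).1 hs
  refine (mem_sigmaZero_iff (h1.trans_le h)).2 ⟨f, fun n => ?_, rfl⟩
  obtain ⟨ζ, h2, h3, h4⟩ := hf n
  exact ⟨ζ, h2, h3.trans_le h, h4⟩

theorem inter_mem_sigmaZero {ξ : Ordinal.{0}} (hξ : 1 ≤ ξ) {s t : Set X}
    (hs : s ∈ SigmaZero X ξ) (ht : t ∈ SigmaZero X ξ) : s ∩ t ∈ SigmaZero X ξ := by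
  rcases hξ.eq_or_lt with rfl | h
  · rw [sigmaZero_one] at *
    exact IsOpen.inter hs ht
  obtain ⟨f, hf, rfl⟩ := (mem_sigmaZero_iff h).1 hs
  obtain ⟨g, hg, rfl⟩ := (mem_sigmaZero_iff h).1 ht
  rw [Set.iUnion_inter_iUnion]
  refine iUnion_mem_sigmaZero hξ fun n => iUnion_mem_sigmaZero hξ fun m => ?_
  obtain ⟨η, h1, h2, h3⟩ := hf n
  obtain ⟨ζ, h1', h2', h3'⟩ := hg m
  refine piZero_subset_sigmaZero (h1.trans (le_max_left η ζ)) (max_lt h2 h2') ?_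
  rw [mem_piZero_iff, Set.compl_inter]
  exact union_mem_sigmaZero (h1.trans (le_max_left η ζ))
    (sigmaZero_mono h1 (le_max_left _ _) h3) (sigmaZero_mono h1' (le_max_right _ _) h3')

theorem biInter_finset_mem_sigmaZero {ι : Type*} {ξ : Ordinal.{0}} (hξ : 1 ≤ ξ) (u : Finset ι)
    {s : ι → Set X} (hs : ∀ i ∈ u, s i ∈ SigmaZero X ξ) : ⋂ i ∈ u, s i ∈ SigmaZero X ξ := by
  classical
  induction u using Finset.induction_on with
  | empty => simpa using isOpen_univ.mem_sigmaZero hξ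
  | insert i u _ ih =>
    rw [Finset.set_biInter_insert]
    exact inter_mem_sigmaZero hξ (hs i (by simp)) (ih fun j hj => hs j (by simp [hj]))

theorem image_mem_piZero {Y : Type*} [TopologicalSpace Y] {f : Y → X} (hf : IsClosedEmbedding f)
    {ξ : Ordinal.{0}} (hξ : 1 ≤ ξ) {s : Set Y} (hs : s ∈ PiZero Y ξ) :
    f '' s ∈ PiZero X ξ := by
  induction ξ using WellFoundedLT.induction generalizing s with
  | _ ξ ih =>
    rcases hξ.eq_or_lt with rfl | h
    · rw [mem_piZero_one] at *
      exact hf.isClosedMap _ hs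
    obtain ⟨g, hg, hs⟩ := (mem_sigmaZero_iff h).1 hs
    have key : (f '' s)ᶜ = (Set.range f)ᶜ ∪ ⋃ n, f '' g n := by
      rw [← Set.image_iUnion, ← hs, Set.image_compl_eq_range_sdiff_image hf.injective]
      have := Set.image_subset_range f s
      ext x
      simp only [Set.mem_union, Set.mem_compl_iff, Set.mem_sdiff]
      grind
    rw [mem_piZero_iff, key]
    refine union_mem_sigmaZero hξ (hf.isClosed_range.isOpen_compl.mem_sigmaZero hξ)
      (iUnion_mem_sigmaZero hξ fun n => ?_)
    obtain ⟨η, h1, h2, h3⟩ := hg n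
    exact piZero_subset_sigmaZero h1 h2 (ih η h2 h1 h3)

end BorelClasses

/-! ### Complete sets -/

/-- The reductions to `B` of the `Π⁰_ξ` subsets of zero-dimensional second countable spaces can be
parametrized by the Cantor space in a jointly continuous way. -/
def ParamComplete (ξ : Ordinal.{0}) (B : Set Cantor) : Prop :=
  ∀ (X : Type) [TopologicalSpace X] [SecondCountableTopology X], ZeroDim X →
    ∃ Φ : Cantor × X → Cantor, Continuous Φ ∧ ∀ S ∈ PiZero X ξ, ∃ y, ∀ x, x ∈ S ↔ Φ (y, x) ∈ B

theorem zeroDim_cantor : ZeroDim Cantor :=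
  ⟨_, isTopologicalBasis_isClopen, fun _ hs => hs⟩

theorem ZeroDim.exists_isClopen_seq {X : Type*} [TopologicalSpace X] [SecondCountableTopology X]
    (hX : ZeroDim X) : ∃ C : ℕ → Set X, (∀ n, IsClopen (C n)) ∧
      ∀ U : Set X, IsOpen U → ∃ N : Set ℕ, U = ⋃ n ∈ N, C n := by
  obtain ⟨b, hb, hclopen⟩ := hX
  obtain ⟨c, hcb, hc, hbasis⟩ := hb.exists_countable
  obtain ⟨C, hC⟩ := (hc.insert ∅).exists_eq_range (Set.insert_nonempty ∅ c)
  refine ⟨C, fun n => ?_, fun U hU => ⟨{n | C n ⊆ U}, ?_⟩⟩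
  · rcases (hC ▸ Set.mem_range_self n : C n ∈ insert ∅ c) with h | h
    · rw [h]
      exact isClopen_empty
    · exact hclopen _ (hcb h)
  · refine subset_antisymm (fun x hx => ?_) (Set.iUnion₂_subset fun n hn => hn)
    obtain ⟨v, hv, hxv, hvU⟩ := hbasis.exists_subset_of_mem_open hx hU
    obtain ⟨n, rfl⟩ : v ∈ Set.range C := hC ▸ Set.mem_insert_of_mem _ hv
    exact Set.mem_biUnion (show n ∈ {n | C n ⊆ U} from hvU) hxv

theorem paramComplete_one : ParamComplete 1 {0} := by
  classical
  intro X _ _ hX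
  obtain ⟨C, hC, hU⟩ := hX.exists_isClopen_seq
  refine ⟨fun p n => if p.1 n = 1 ∧ p.2 ∈ C n then 1 else 0, ?_, fun S hS => ?_⟩
  · refine continuous_pi fun n => ?_
    have : IsClopen {p : Cantor × X | p.1 n = 1 ∧ p.2 ∈ C n} :=
      ((isClopen_discrete {1}).preimage ((continuous_apply n).comp continuous_fst)).inter
        ((hC n).preimage continuous_snd)
    exact continuous_const.if (fun p hp => by simp [this.frontier_eq] at hp) continuous_const
  · obtain ⟨N, hN⟩ := hU Sᶜ (mem_piZero_one.1 hS).isOpen_compl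
    refine ⟨fun n => if n ∈ N then 1 else 0, fun x => ?_⟩
    have : x ∈ Sᶜ ↔ ∃ n ∈ N, x ∈ C n := by simp [hN]
    rw [← not_iff_not, ← Set.mem_compl_iff, this, Set.mem_singleton_iff, funext_iff]
    push Not
    refine exists_congr fun n => ?_
    by_cases h1 : n ∈ N <;> by_cases h2 : x ∈ C n <;> simp [h1, h2]

/-- The `n`-th row of a sequence, seen as a matrix through the pairing of natural numbers. -/
def row {β : Type*} (α : ℕ → β) (n : ℕ) : ℕ → β := fun j => α (Nat.pair n j)

theorem continuous_row {β : Type*} [TopologicalSpace β] (n : ℕ) :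
    Continuous fun α : ℕ → β => row α n :=
  continuous_pi fun _ => continuous_apply _

/-- The sequence with given rows. -/
def ofRows {β : Type*} (r : ℕ → ℕ → β) : ℕ → β := fun k => r k.unpair.1 k.unpair.2

@[simp]
theorem row_ofRows {β : Type*} (r : ℕ → ℕ → β) (n : ℕ) : row (ofRows r) n = r n := by
  funext j
  simp [row, ofRows]

theorem exists_seq_ordinal {ξ : Ordinal.{0}} (hξ : 1 < ξ) (hcount : ξ.card ≤ Cardinal.aleph0) :
    ∃ e : ℕ → Ordinal.{0}, (∀ n, 1 ≤ e n ∧ e n < ξ) ∧ ∀ η, 1 ≤ η → η < ξ → ∃ n, e n = η := by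
  have hI : (Set.Iio ξ).Countable := by
    rw [← Cardinal.le_aleph0_iff_set_countable, Cardinal.mk_Iio_ordinal]
    simpa [← Ordinal.lift_card] using hcount
  obtain ⟨e, he⟩ := (hI.mono (s₁ := Set.Ico 1 ξ) fun _ h => h.2).exists_eq_range ⟨1, le_rfl, hξ⟩
  refine ⟨e, fun n => ?_, fun η h1 h2 => ?_⟩
  · exact (he ▸ Set.mem_range_self n : e n ∈ Set.Ico 1 ξ)
  · exact (he ▸ ⟨h1, h2⟩ : η ∈ Set.range e)

theorem exists_paramComplete (ξ : Ordinal.{0}) (hξ : 1 ≤ ξ) (hcount : ξ.card ≤ Cardinal.aleph0) :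
    ∃ B ∈ PiZero Cantor ξ, ParamComplete ξ B := by
  induction ξ using WellFoundedLT.induction with
  | _ ξ ih =>
    rcases hξ.eq_or_lt with rfl | h
    · exact ⟨{0}, mem_piZero_one.2 isClosed_singleton, paramComplete_one⟩
    obtain ⟨e, he, hsurj⟩ := exists_seq_ordinal h hcount
    choose B hB hcomplete using fun n =>
      ih (e n) (he n).2 (he n).1 ((Ordinal.card_le_card (he n).2.le).trans hcount)
    refine ⟨{α | ∀ k : ℕ, row α k ∉ B k.unpair.1}, ?_, fun X _ _ hX => ?_⟩
    · refine (mem_sigmaZero_iff h).2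
        ⟨fun k => (fun α => row α k) ⁻¹' B k.unpair.1, fun k => ?_, ?_⟩
      · exact ⟨e k.unpair.1, (he _).1, (he _).2,
          preimage_mem_piZero (continuous_row k) (he _).1 (hB _)⟩
      · ext α
        simp
    choose Φ hΦ hred using fun n => hcomplete n X hX
    refine ⟨fun p => ofRows fun k => Φ k.unpair.1 (row p.1 k, p.2), ?_, fun S hS => ?_⟩
    · exact continuous_pi fun j => (continuous_apply _).comp ((hΦ _).comp
        (((continuous_row _).comp continuous_fst).prodMk continuous_snd))
    obtain ⟨f, hf, hS⟩ := (mem_sigmaZero_iff h).1 hS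
    have hy : ∀ k : ℕ, ∃ y, ∀ x,
        (x ∈ f k.unpair.2 ∧ f k.unpair.2 ∈ PiZero X (e k.unpair.1)) ↔
          Φ k.unpair.1 (y, x) ∈ B k.unpair.1 := by
      intro k
      by_cases hk : f k.unpair.2 ∈ PiZero X (e k.unpair.1)
      · simpa [hk] using hred _ _ hk
      · simpa [hk] using hred k.unpair.1 ∅ (empty_mem_piZero (he _).1)
    choose y hy using hy
    refine ⟨ofRows y, fun x => ?_⟩
    simp only [Set.mem_ofPred_eq, row_ofRows, ← hy]
    rw [← not_iff_not, ← Set.mem_compl_iff, hS, Set.mem_iUnion]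
    push Not
    constructor
    · rintro ⟨n, hn⟩
      obtain ⟨η, h1, h2, h3⟩ := hf n
      obtain ⟨m, rfl⟩ := hsurj η h1 h2
      exact ⟨Nat.pair m n, by simpa using hn, by simpa using h3⟩
    · rintro ⟨k, hk, -⟩
      exact ⟨_, hk⟩

theorem ParamComplete.notMem_sigmaZero {ξ : Ordinal.{0}} (hξ : 1 ≤ ξ) {B : Set Cantor}
    (hB : ParamComplete ξ B) : B ∉ SigmaZero Cantor ξ := by
  intro hmem
  obtain ⟨Φ, hΦ, hred⟩ := hB Cantor zeroDim_cantor
  obtain ⟨y, hy⟩ := hred ((fun x => Φ (x, x)) ⁻¹' B)ᶜ (compl_mem_piZero.2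
    (preimage_mem_sigmaZero (hΦ.comp (continuous_id.prodMk continuous_id)) hξ hmem))
  have := hy y
  simp at this

theorem ParamComplete.exists_reduction {ξ : Ordinal.{0}} {B : Set Cantor}
    (hB : ParamComplete ξ B) {X : Type} [TopologicalSpace X] [SecondCountableTopology X]
    (hX : ZeroDim X) {S : Set X} (hS : S ∈ PiZero X ξ) :
    ∃ f : X → Cantor, Continuous f ∧ S = f ⁻¹' B := by
  obtain ⟨Φ, hΦ, hred⟩ := hB X hX
  obtain ⟨y, hy⟩ := hred S hS
  exact ⟨fun x => Φ (y, x), hΦ.comp (continuous_const.prodMk continuous_id), Set.ext hy⟩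

/-! ### Borel sets as projections of closed sets -/

/-- The set `B` is the projection of the closed set `F` on the Cantor space, and prescribing some
of the coordinates of the witness yields projections in the class `Γ`. -/
structure IsClosedCover (Γ : Set (Set Cantor)) (B : Set Cantor) (F : Set (Cantor × (ℕ → ℕ))) :
    Prop where
  isClosed : IsClosed F
  mem_iff : ∀ α, α ∈ B ↔ ∃ β, (α, β) ∈ F
  proj_mem : ∀ (D : Set ℕ) (t : ℕ → ℕ), {α | ∃ β, (∀ k ∈ D, β k = t k) ∧ (α, β) ∈ F} ∈ Γ

/-- Prepend a value to a sequence. -/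
def consSeq {β : Type*} (b : β) (s : ℕ → β) : ℕ → β
  | 0 => b
  | n + 1 => s n

/-- Drop the first value of a sequence. -/
def tailSeq {β : Type*} (s : ℕ → β) : ℕ → β := fun n => s (n + 1)

theorem continuous_tailSeq {β : Type*} [TopologicalSpace β] :
    Continuous (tailSeq : (ℕ → β) → ℕ → β) :=
  continuous_pi fun _ => continuous_apply _

theorem exists_isClosedCover_iUnion {ξ : Ordinal.{0}} (hξ : 1 ≤ ξ) {B : ℕ → Set Cantor}
    {F : ℕ → Set (Cantor × (ℕ → ℕ))} {Γ : ℕ → Set (Set Cantor)}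
    (hΓ : ∀ n, Γ n ⊆ SigmaZero Cantor ξ) (hF : ∀ n, IsClosedCover (Γ n) (B n) (F n)) :
    ∃ F', IsClosedCover (SigmaZero Cantor ξ) (⋃ n, B n) F' := by
  refine ⟨{p | ∀ n, p.2 0 = n → (p.1, tailSeq p.2) ∈ F n}, ?_, fun α => ?_, fun D t => ?_⟩
  · simp only [Set.ofPred_forall]
    refine isClosed_iInter fun n => isClosed_imp ?_ ?_
    · exact (isOpen_discrete {n}).preimage
        (f := fun p : Cantor × (ℕ → ℕ) => p.2 0) ((continuous_apply 0).comp continuous_snd)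
    · exact (hF n).isClosed.preimage
        (continuous_fst.prodMk (continuous_tailSeq.comp continuous_snd))
  · simp only [Set.mem_iUnion, (hF _).mem_iff, Set.mem_ofPred_eq, forall_eq']
    constructor
    · rintro ⟨n, β, h⟩
      exact ⟨consSeq n β, h⟩
    · rintro ⟨β, h⟩
      exact ⟨_, _, h⟩
  · have : {α | ∃ β : ℕ → ℕ, (∀ k ∈ D, β k = t k) ∧
          (α, β) ∈ {p : Cantor × (ℕ → ℕ) | ∀ n, p.2 0 = n → (p.1, tailSeq p.2) ∈ F n}} =
        ⋃ n : {n // 0 ∈ D → n = t 0},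
          {α | ∃ β, (∀ k ∈ {k | k + 1 ∈ D}, β k = tailSeq t k) ∧ (α, β) ∈ F n} := by
      ext α
      simp only [Set.mem_ofPred_eq, forall_eq', Set.mem_iUnion, Subtype.exists, exists_prop]
      constructor
      · rintro ⟨β, h1, h2⟩
        exact ⟨β 0, h1 0, tailSeq β, fun k hk => h1 _ hk, h2⟩
      · rintro ⟨n, h0, β, h1, h2⟩
        refine ⟨consSeq n β, ?_, h2⟩
        rintro (_ | k) hk
        exacts [h0 hk, h1 k hk]
    rw [this]
    exact iUnion_mem_sigmaZero hξ fun n => hΓ _ ((hF n).proj_mem _ _)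

theorem exists_isClosedCover_iInter {ξ : Ordinal.{0}} (hξ : 1 ≤ ξ) {B : ℕ → Set Cantor}
    {F : ℕ → Set (Cantor × (ℕ → ℕ))} {Γ : ℕ → Set (Set Cantor)}
    (hΓ : ∀ n, Γ n ⊆ PiZero Cantor ξ) (hF : ∀ n, IsClosedCover (Γ n) (B n) (F n)) :
    ∃ F', IsClosedCover (PiZero Cantor ξ) (⋂ n, B n) F' := by
  refine ⟨{p | ∀ n, (p.1, row p.2 n) ∈ F n}, ?_, fun α => ?_, fun D t => ?_⟩
  · simp only [Set.ofPred_forall]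
    exact isClosed_iInter fun n => (hF n).isClosed.preimage
      (continuous_fst.prodMk ((continuous_row n).comp continuous_snd))
  · simp only [Set.mem_iInter, (hF _).mem_iff, Set.mem_ofPred_eq]
    constructor
    · intro h
      choose β hβ using h
      exact ⟨ofRows β, by simpa using hβ⟩
    · rintro ⟨β, h⟩ n
      exact ⟨_, h n⟩
  · have : {α | ∃ β : ℕ → ℕ, (∀ k ∈ D, β k = t k) ∧
          (α, β) ∈ {p : Cantor × (ℕ → ℕ) | ∀ n, (p.1, row p.2 n) ∈ F n}} =
        ⋂ n, {α | ∃ β, (∀ k ∈ {k | Nat.pair n k ∈ D}, β k = row t n k) ∧ (α, β) ∈ F n} := by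
      ext α
      simp only [Set.mem_ofPred_eq, Set.mem_iInter]
      constructor
      · rintro ⟨β, h1, h2⟩ n
        exact ⟨row β n, fun k hk => h1 _ hk, h2 n⟩
      · intro h
        choose β h1 h2 using h
        refine ⟨ofRows β, fun k hk => ?_, by simpa using h2⟩
        have := h1 k.unpair.1 k.unpair.2 (by simpa using hk)
        simpa [row, ofRows] using this
    rw [this]
    exact iInter_mem_piZero hξ fun n => hΓ _ ((hF n).proj_mem _ _)

theorem IsClosed.isClosedCover {ξ : Ordinal.{0}} (hξ : 1 ≤ ξ) {B : Set Cantor} (hB : IsClosed B) :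
    IsClosedCover (PiZero Cantor ξ) B (Prod.fst ⁻¹' B) where
  isClosed := hB.preimage continuous_fst
  mem_iff α := by simp
  proj_mem D t := by
    have : {α | ∃ β : ℕ → ℕ, (∀ k ∈ D, β k = t k) ∧ (α, β) ∈ Prod.fst ⁻¹' B} = B := by
      ext α
      exact ⟨fun ⟨β, _, h⟩ => h, fun h => ⟨t, fun _ _ => rfl, h⟩⟩
    rw [this]
    exact hB.mem_piZero hξ

theorem exists_isClosedCover (ξ : Ordinal.{0}) (hξ : 1 ≤ ξ) :
    (∀ B ∈ SigmaZero Cantor ξ, ∃ F, IsClosedCover (SigmaZero Cantor ξ) B F) ∧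
      ∀ B ∈ PiZero Cantor ξ, ∃ F, IsClosedCover (PiZero Cantor ξ) B F := by
  induction ξ using WellFoundedLT.induction with
  | _ ξ ih =>
    rcases hξ.eq_or_lt with rfl | h
    · refine ⟨fun B hB => ?_, fun B hB => ⟨_, (mem_piZero_one.1 hB).isClosedCover le_rfl⟩⟩
      obtain ⟨C, hC, hU⟩ := zeroDim_cantor.exists_isClopen_seq
      rw [sigmaZero_one] at hB
      obtain ⟨N, rfl⟩ := hU B hB
      have hclopen : ∀ n, IsClopen (⋃ _ : n ∈ N, C n) := fun n => by
        by_cases hn : n ∈ N <;> simp [hn, hC n, isClopen_empty]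
      refine exists_isClosedCover_iUnion (B := fun n => ⋃ _ : n ∈ N, C n) le_rfl
        (F := fun n => Prod.fst ⁻¹' (⋃ _ : n ∈ N, C n))
        (Γ := fun n => {⋃ _ : n ∈ N, C n}) ?_ fun n => ⟨?_, ?_, ?_⟩
      · rintro n _ rfl
        rw [sigmaZero_one]
        exact (hclopen n).isOpen
      · exact (hclopen n).isClosed.preimage continuous_fst
      · simp
      · intro D t
        rw [Set.mem_singleton_iff]
        ext α
        exact ⟨fun ⟨β, _, h⟩ => h, fun h => ⟨t, fun _ _ => rfl, h⟩⟩
    refine ⟨fun B hB => ?_, fun B hB => ?_⟩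
    · obtain ⟨f, hf, rfl⟩ := (mem_sigmaZero_iff h).1 hB
      choose η h1 h2 h3 using hf
      choose F hF using fun n => (ih (η n) (h2 n) (h1 n)).2 _ (h3 n)
      exact exists_isClosedCover_iUnion hξ
        (fun n s hs => piZero_subset_sigmaZero (h1 n) (h2 n) hs) hF
    · obtain ⟨f, hf, hB⟩ := (mem_sigmaZero_iff h).1 hB
      choose η h1 h2 h3 using hf
      choose F hF using fun n => (ih (η n) (h2 n) (h1 n)).1 (f n)ᶜ (h3 n)
      rw [← compl_compl B, hB, Set.compl_iUnion]
      exact exists_isClosedCover_iInter hξ (fun n s hs =>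
        piZero_subset_sigmaZero (h1 n) (h2 n) (compl_mem_piZero.2 hs)) hF

/-! ### Parsing infinite words -/

section Parsing

variable {β : Type*}

/-- The sequence obtained by dropping the first `p` letters. -/
def dropSeq (z : ℕ → β) (p : ℕ) : ℕ → β := fun k => z (p + k)

/-- The word consisting of the first `L` letters. -/
def takeSeq (z : ℕ → β) (L : ℕ) : List β := (List.range L).map z

@[simp]
theorem length_takeSeq (z : ℕ → β) (L : ℕ) : (takeSeq z L).length = L := by simp [takeSeq]

@[simp]
theorem dropSeq_zero (z : ℕ → β) : dropSeq z 0 = z := by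
  funext k
  simp [dropSeq]

@[simp]
theorem dropSeq_dropSeq (z : ℕ → β) (p q : ℕ) : dropSeq (dropSeq z p) q = dropSeq z (p + q) := by
  funext k
  simp [dropSeq, add_assoc]

theorem takeSeq_add (z : ℕ → β) (p L : ℕ) :
    takeSeq z (p + L) = takeSeq z p ++ takeSeq (dropSeq z p) L := by
  simp [takeSeq, List.range_add, dropSeq, Function.comp_def]

theorem takeSeq_inj {z z' : ℕ → β} {L L' : ℕ} :
    takeSeq z L = takeSeq z' L' ↔ L = L' ∧ ∀ k < L, z k = z' k := by
  constructor
  · intro h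
    obtain rfl : L = L' := by simpa using congrArg List.length h
    exact ⟨rfl, by simpa [takeSeq] using h⟩
  · rintro ⟨rfl, h⟩
    simpa [takeSeq] using h

theorem concatPrefix_succ (a : ℕ → List β) (m : ℕ) :
    concatPrefix a (m + 1) = concatPrefix a m ++ a m := by
  simp [concatPrefix, List.range_succ]

theorem concatPrefix_succ' (a : ℕ → List β) (m : ℕ) :
    concatPrefix a (m + 1) = a 0 ++ concatPrefix (fun i => a (i + 1)) m := by
  simp [concatPrefix, List.range_succ_eq_map, Function.comp_def]

theorem mem_omegaPower_iff {A : Set (List β)} {z : ℕ → β} :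
    z ∈ omegaPower A ↔ ∃ a : ℕ → List β, (∀ i, a i ∈ A) ∧
      (∀ n, ∃ m, n ≤ (concatPrefix a m).length) ∧
      ∀ m, concatPrefix a m = takeSeq z (concatPrefix a m).length := by
  have key : ∀ l : List β, (∀ k (h : k < l.length), l.get ⟨k, h⟩ = z k) ↔
      l = takeSeq z l.length := by
    intro l
    constructor
    · intro h
      exact List.ext_get (by simp) fun k h1 h2 => by simpa [takeSeq] using h k h1
    · intro h k hk
      have : l[k]? = (takeSeq z l.length)[k]? := by rw [← h]
      simpa [takeSeq, hk] using this
  simp only [omegaPower, Set.mem_ofPred_eq, key]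

theorem exists_takeSeq_mem {A : Set (List β)} (hA : [] ∉ A) {z : ℕ → β}
    (hz : z ∈ omegaPower A) : ∃ L > 0, takeSeq z L ∈ A ∧ dropSeq z L ∈ omegaPower A := by
  obtain ⟨a, haA, hlen, ha⟩ := mem_omegaPower_iff.1 hz
  have h0 : a 0 = takeSeq z (a 0).length := by
    simpa [concatPrefix_succ, concatPrefix] using ha 1
  refine ⟨(a 0).length, ?_, h0 ▸ haA 0, mem_omegaPower_iff.2
    ⟨fun i => a (i + 1), fun i => haA _, fun n => ?_, fun m => ?_⟩⟩
  · rw [gt_iff_lt, List.length_pos_iff]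
    intro h
    exact hA (h ▸ haA 0)
  · obtain ⟨m, hm⟩ := hlen (n + (a 0).length)
    rcases m with _ | m
    · simp only [concatPrefix, List.range_zero, List.map_nil, List.flatten_nil,
        List.length_nil] at hm
      exact ⟨0, by omega⟩
    · rw [concatPrefix_succ', List.length_append] at hm
      exact ⟨m, by omega⟩
  · have := ha (m + 1)
    rw [concatPrefix_succ', List.length_append, takeSeq_add, ← h0] at this
    exact List.append_cancel_left this

/-- Coinduction principle for ω-powers. -/
theorem mem_omegaPower_of_forall {A : Set (List β)} {P : Set (ℕ → β)}
    (h : ∀ z ∈ P, ∃ L > 0, takeSeq z L ∈ A ∧ dropSeq z L ∈ P) {z : ℕ → β} (hz : z ∈ P) :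
    z ∈ omegaPower A := by
  choose! L hL hA hP using h
  let p : ℕ → ℕ := fun n => Nat.rec 0 (fun _ q => q + L (dropSeq z q)) n
  have hp : ∀ n, p (n + 1) = p n + L (dropSeq z (p n)) := fun n => rfl
  have hmem : ∀ n, dropSeq z (p n) ∈ P := by
    intro n
    induction n with
    | zero => simpa [p] using hz
    | succ n ih =>
      rw [hp, ← dropSeq_dropSeq]
      exact hP _ ih
  have hconcat : ∀ n, concatPrefix (fun n => takeSeq (dropSeq z (p n)) (L (dropSeq z (p n)))) n =
      takeSeq z (p n) := by
    intro n
    induction n with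
    | zero => simp [p, concatPrefix, takeSeq]
    | succ n ih => rw [concatPrefix_succ, ih, hp, takeSeq_add]
  have hle : ∀ n, n ≤ p n := by
    intro n
    induction n with
    | zero => simp
    | succ n ih =>
      have := hL _ (hmem n)
      rw [hp]
      omega
  exact mem_omegaPower_iff.2 ⟨_, fun n => hA _ (hmem n),
    fun n => ⟨n, by simpa [hconcat] using hle n⟩,
    fun n => by simp [hconcat]⟩

theorem omegaPower_mono {A A' : Set (List β)} (hA : [] ∉ A) (h : A ⊆ A') :
    omegaPower A ⊆ omegaPower A' := fun _ hz =>
  mem_omegaPower_of_forall (P := omegaPower A) (fun _ hz =>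
    let ⟨L, h1, h2, h3⟩ := exists_takeSeq_mem hA hz
    ⟨L, h1, h h2, h3⟩) hz

/-- The position `p` of the sequence `z` can be reached by reading words of `A`. -/
inductive Reachable (A : Set (List β)) (z : ℕ → β) : ℕ → Prop
  | zero : Reachable A z 0
  | step {p L : ℕ} : Reachable A z p → takeSeq (dropSeq z p) L ∈ A → 0 < L → Reachable A z (p + L)

theorem Reachable.congr {A : Set (List β)} {z z' : ℕ → β} {p : ℕ} (h : Reachable A z p)
    (hz : ∀ k < p, z k = z' k) : Reachable A z' p := by
  induction h with
  | zero => exact .zero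
  | @step p L _ hL hpos ih =>
    refine .step (ih fun k hk => hz k (by omega)) ?_ hpos
    have h : takeSeq (dropSeq z p) L = takeSeq (dropSeq z' p) L :=
      takeSeq_inj.2 ⟨rfl, fun k hk => hz (p + k) (by omega)⟩
    rwa [← h]

theorem Reachable.mem_omegaPower {A : Set (List β)} (hA : [] ∉ A) {z : ℕ → β} {p : ℕ}
    (h : Reachable A z p) (hz : dropSeq z p ∈ omegaPower A) : z ∈ omegaPower A := by
  induction h with
  | zero => simpa using hz
  | @step p L _ hL hpos ih =>
    refine ih (mem_omegaPower_of_forall (P := {w | ∃ L > 0, takeSeq w L ∈ A ∧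
      dropSeq w L ∈ omegaPower A}) ?_ ⟨L, hpos, hL, by simpa using hz⟩)
    rintro w ⟨L, h1, h2, h3⟩
    exact ⟨L, h1, h2, exists_takeSeq_mem hA h3⟩

theorem exists_reachable_le {A : Set (List β)} (hA : [] ∉ A) {z : ℕ → β} (hz : z ∈ omegaPower A)
    (N : ℕ) : ∃ p ≤ N, ∃ L, N < p + L ∧ Reachable A z p ∧ takeSeq (dropSeq z p) L ∈ A ∧
      dropSeq z p ∈ omegaPower A := by
  classical
  obtain ⟨h1, h2⟩ := Nat.findGreatest_spec
    (P := fun p => Reachable A z p ∧ dropSeq z p ∈ omegaPower A) (Nat.zero_le N)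
    ⟨.zero, by simpa using hz⟩
  obtain ⟨L, hL, h3, h4⟩ := exists_takeSeq_mem hA h2
  refine ⟨_, Nat.findGreatest_le N, L, ?_, h1, h3, h2⟩
  by_contra! h
  have := Nat.le_findGreatest (P := fun p => Reachable A z p ∧ dropSeq z p ∈ omegaPower A) h
    ⟨.step h1 h3 hL, by simpa using h4⟩
  omega

end Parsing

/-! ### Block decomposition of binary sequences -/

/-- The starting position of the `n`-th block in `0 ^ x₀ 1 0 ^ x₁ 1 ⋯`. -/
def blockStart (x : ℕ → ℕ) : ℕ → ℕ
  | 0 => 0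
  | n + 1 => blockStart x n + x n + 1

open Classical in
/-- The binary sequence `0 ^ x₀ 1 0 ^ x₁ 1 ⋯`. -/
noncomputable def blockSeq (x : ℕ → ℕ) : Cantor := fun k =>
  if ∃ n, k + 1 = blockStart x (n + 1) then 1 else 0

theorem blockSeq_eq_one {x : ℕ → ℕ} {k : ℕ} :
    blockSeq x k = 1 ↔ ∃ n, k + 1 = blockStart x (n + 1) := by
  simp [blockSeq]

theorem cantor_ext {z z' : Cantor} (h : ∀ k, z k = 1 ↔ z' k = 1) : z = z' := by
  funext k
  have := h k
  omega

theorem strictMono_blockStart (x : ℕ → ℕ) : StrictMono (blockStart x) :=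
  strictMono_nat_of_lt_succ fun n => by simp only [blockStart]; omega

theorem blockStart_congr {x y : ℕ → ℕ} {n : ℕ} (h : ∀ l < n, x l = y l) :
    blockStart x n = blockStart y n := by
  induction n with
  | zero => rfl
  | succ n ih =>
    simp only [blockStart]
    rw [ih fun l hl => h l (by omega), h n (by omega)]

theorem blockSeq_one_at (x : ℕ → ℕ) (n : ℕ) : blockSeq x (blockStart x n + x n) = 1 :=
  blockSeq_eq_one.2 ⟨n, rfl⟩

/-- If the current block of `x` starts at the beginning of a block of `y`, and both sequences agree
on the letters following it, then the block of `y` cannot be longer. -/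
theorem block_le_of_agree {x y : ℕ → ℕ} {n : ℕ} (h : blockStart x n = blockStart y n)
    (hone : blockSeq y (blockStart x n + x n) = 1) : y n ≤ x n := by
  obtain ⟨i, hi⟩ := blockSeq_eq_one.1 hone
  have h1 : blockStart y n < blockStart y (i + 1) := by omega
  have h2 : n + 1 ≤ i + 1 := (strictMono_blockStart y).lt_iff_lt.1 h1
  have h3 := (strictMono_blockStart y).monotone h2
  simp only [blockStart] at h3 hi
  omega

theorem eq_of_blockSeq_agree {x y : ℕ → ℕ} {n : ℕ}
    (h : ∀ k < blockStart x n, blockSeq x k = blockSeq y k) : ∀ l < n, x l = y l := by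
  induction n with
  | zero => simp
  | succ n ih =>
    have ih := ih fun k hk => h k (hk.trans (strictMono_blockStart x n.lt_succ_self))
    have hstart := blockStart_congr ih
    have h1 : y n ≤ x n := by
      refine block_le_of_agree hstart ?_
      rw [← h _ (by simp [blockStart]), blockSeq_one_at]
    have h2 : x n ≤ y n := by
      refine block_le_of_agree hstart.symm ?_
      rw [h _ (by simp only [blockStart]; omega), blockSeq_one_at]
    intro l hl
    rcases Nat.lt_succ_iff_lt_or_eq.1 hl with hl | rfl
    · exact ih l hl
    · omega

theorem blockSeq_injective : Function.Injective blockSeq := fun x y h =>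
  funext fun l => eq_of_blockSeq_agree (n := l + 1) (fun k _ => by rw [h]) l l.lt_succ_self

/-- The block lengths after dropping `n` blocks and the first `o` letters of the next one. -/
def dropBlocks (x : ℕ → ℕ) (n o : ℕ) : ℕ → ℕ := consSeq (x n - o) fun l => x (n + l + 1)

theorem blockStart_dropBlocks {x : ℕ → ℕ} {n o : ℕ} (ho : o ≤ x n) (l : ℕ) :
    blockStart (dropBlocks x n o) (l + 1) + (blockStart x n + o) = blockStart x (n + l + 1) := by
  induction l with
  | zero =>
    simp only [blockStart, dropBlocks, consSeq]
    omega
  | succ l ih =>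
    have h1 : blockStart (dropBlocks x n o) (l + 1 + 1) =
      blockStart (dropBlocks x n o) (l + 1) + x (n + l + 1) + 1 := rfl
    have h2 : blockStart x (n + (l + 1) + 1) = blockStart x (n + l + 1) + x (n + l + 1) + 1 := rfl
    omega

theorem dropSeq_blockSeq {x : ℕ → ℕ} {n o : ℕ} (ho : o ≤ x n) :
    dropSeq (blockSeq x) (blockStart x n + o) = blockSeq (dropBlocks x n o) := by
  refine cantor_ext fun k => ?_
  simp only [dropSeq, blockSeq_eq_one]
  constructor
  · rintro ⟨i, hi⟩
    have h1 : n < i + 1 := (strictMono_blockStart x).lt_iff_lt.1 (by omega)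
    refine ⟨i - n, ?_⟩
    have := blockStart_dropBlocks ho (i - n)
    rw [show n + (i - n) + 1 = i + 1 by omega] at this
    omega
  · rintro ⟨i, hi⟩
    have := blockStart_dropBlocks ho i
    exact ⟨n + i, by omega⟩

theorem exists_block (x : ℕ → ℕ) (p : ℕ) : ∃ n o, o ≤ x n ∧ p = blockStart x n + o := by
  induction p with
  | zero => exact ⟨0, 0, by simp [blockStart]⟩
  | succ p ih =>
    obtain ⟨n, o, ho, rfl⟩ := ih
    rcases ho.lt_or_eq with h | rfl
    · exact ⟨n, o + 1, h, by omega⟩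
    · exact ⟨n + 1, 0, by simp, by simp [blockStart]⟩

theorem exists_eq_blockSeq {z : Cantor} (hz : ∀ N, ∃ k ≥ N, z k = 1) : ∃ x, z = blockSeq x := by
  have hinf : {k | z k = 1}.Infinite := Set.infinite_of_forall_exists_gt fun N =>
    let ⟨k, hk, h⟩ := hz (N + 1)
    ⟨k, h, hk⟩
  let u := Nat.nth fun k => z k = 1
  have hu : StrictMono u := Nat.nth_strictMono hinf
  let x : ℕ → ℕ := consSeq (u 0) fun n => u (n + 1) - (u n + 1)
  have hx : ∀ n, blockStart x (n + 1) = u n + 1 := by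
    intro n
    induction n with
    | zero => simp [blockStart, x, consSeq]
    | succ n ih =>
      rw [blockStart, ih]
      have : u n < u (n + 1) := hu n.lt_succ_self
      simp only [x, consSeq]
      omega
  refine ⟨x, cantor_ext fun k => ?_⟩
  rw [blockSeq_eq_one]
  have : k ∈ Set.range u ↔ z k = 1 := by
    rw [Nat.range_nth_of_infinite hinf]
    rfl
  simp [← this, hx, eq_comm]

/-! ### The nodes of the binary tree and the codes of finite sequences -/

/-- The index in the binary heap of the restriction of `α` to its first `n` letters. -/
def node (α : Cantor) : ℕ → ℕ
  | 0 => 1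
  | n + 1 => 2 * node α n + (α n).val

theorem node_succ_div_two (α : Cantor) (n : ℕ) : node α (n + 1) / 2 = node α n := by
  simp only [node]
  omega

theorem lt_node (α : Cantor) (n : ℕ) : n < node α n := by
  induction n with
  | zero => simp [node]
  | succ n ih =>
    simp only [node]
    omega

theorem node_congr {α α' : Cantor} {n : ℕ} (h : ∀ j < n, α j = α' j) : node α n = node α' n := by
  induction n with
  | zero => rfl
  | succ n ih =>
    simp only [node]
    rw [ih fun j hj => h j (by omega), h n (by omega)]

theorem node_inj {α α' : Cantor} {n n' : ℕ} :
    node α n = node α' n' → n = n' ∧ ∀ j < n, α j = α' j := by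
  induction n generalizing n' with
  | zero =>
    intro h
    rcases n' with _ | n'
    · simp
    · have := lt_node α' n'
      simp only [node] at h
      omega
  | succ n ih =>
    intro h
    rcases n' with _ | n'
    · have := lt_node α n
      simp only [node] at h
      omega
    · simp only [node] at h
      obtain ⟨rfl, h2⟩ := ih (n' := n') (by omega)
      refine ⟨rfl, fun j hj => ?_⟩
      rcases Nat.lt_succ_iff_lt_or_eq.1 hj with hj | rfl
      · exact h2 j hj
      · omega

/-- The code of the restriction of `β` to its first `n` values. -/
def code (β : ℕ → ℕ) : ℕ → ℕ
  | 0 => 0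
  | n + 1 => Nat.pair (code β n) (β n) + 1

theorem code_congr {β β' : ℕ → ℕ} {n : ℕ} (h : ∀ j < n, β j = β' j) : code β n = code β' n := by
  induction n with
  | zero => rfl
  | succ n ih =>
    simp only [code]
    rw [ih fun j hj => h j (by omega), h n (by omega)]

theorem code_inj {β β' : ℕ → ℕ} {n n' : ℕ} :
    code β n = code β' n' → n = n' ∧ ∀ j < n, β j = β' j := by
  induction n generalizing n' with
  | zero =>
    rcases n' with _ | n' <;> simp [code]
  | succ n ih =>
    intro h
    rcases n' with _ | n'
    · simp [code] at h
    · simp only [code, Nat.add_right_cancel_iff, Nat.pair_eq_pair] at h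
      obtain ⟨rfl, h2⟩ := ih h.1
      refine ⟨rfl, fun j hj => ?_⟩
      rcases Nat.lt_succ_iff_lt_or_eq.1 hj with hj | rfl
      · exact h2 j hj
      · exact h.2

/-- The block lengths `a, node α (i + 1), node α (i + 2), …`. -/
def nodeBlocks (a i : ℕ) (α : Cantor) : ℕ → ℕ := consSeq a fun l => node α (i + l + 1)

theorem nodeBlocks_succ_div_two {a i : ℕ} {α : Cantor} {l : ℕ} (hl : 1 ≤ l) :
    nodeBlocks a i α (l + 1) / 2 = nodeBlocks a i α l := by
  obtain ⟨l, rfl⟩ := Nat.exists_eq_add_of_le' hl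
  exact node_succ_div_two α (i + l + 1)

theorem dropBlocks_nodeBlocks (a i : ℕ) (α : Cantor) (k o : ℕ) :
    dropBlocks (nodeBlocks a i α) (k + 1) o =
      nodeBlocks (node α (i + k + 1) - o) (i + k + 1) α := by
  funext l
  rcases l with _ | l
  · rfl
  · simp only [dropBlocks, nodeBlocks, consSeq]
    congr 1
    omega

theorem exists_eq_nodeBlocks {x : ℕ → ℕ} (hx : ∀ l ≥ 1, x (l + 1) / 2 = x l) {α : Cantor} {i : ℕ}
    (h1 : x 1 = node α (i + 1)) :
    ∃ α', x = nodeBlocks (x 0) i α' ∧ node α' i = node α i := by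
  let α' : Cantor := fun j => if j < i + 1 then α j else Fin.ofNat 2 (x (j - i + 1))
  have hα : ∀ n ≤ i + 1, node α' n = node α n := fun n hn =>
    node_congr fun j hj => if_pos (by omega)
  refine ⟨α', ?_, hα i (by omega)⟩
  funext l
  rcases l with _ | l
  · rfl
  simp only [nodeBlocks, consSeq]
  induction l with
  | zero => rw [h1, Nat.add_zero, hα _ le_rfl]
  | succ l ih =>
    have := hx (l + 1) (by omega)
    have h2 : α' (i + l + 1) = Fin.ofNat 2 (x (l + 1 + 1)) := by
      simp only [α']
      rw [if_neg (by omega)]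
      congr 2
      omega
    rw [← add_assoc, node, ← ih, h2, Fin.val_ofNat]
    omega

/-! ### The finitary language attached to a closed set -/

/-- The words describing one step of a run guessing a witness for the closed set `F`. -/
def stepWords (F : Set (Cantor × (ℕ → ℕ))) : Set (List (Fin 2)) :=
  {w | ∃ (α : Cantor) (β : ℕ → ℕ) (m i a k : ℕ), (α, β) ∈ F ∧ 1 ≤ k ∧ code β m + a = node α i ∧
    code β (m + 1) ≤ node α (i + k + 1) ∧
    w = takeSeq (blockSeq (nodeBlocks a i α))
      (blockStart (nodeBlocks a i α) (k + 1) + code β (m + 1))}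

/-- The words ending with two consecutive blocks whose lengths are not consistent. -/
def errorWords : Set (List (Fin 2)) :=
  {w | ∃ (x : ℕ → ℕ) (k : ℕ), 1 ≤ k ∧ x (k + 1) / 2 ≠ x k ∧
    w = takeSeq (blockSeq x) (blockStart x (k + 2))}

/-- The sequence `z` does not start with an error word. -/
def ErrorFree (z : Cantor) : Prop := ∀ L, takeSeq z L ∉ errorWords

theorem takeSeq_blockSeq_mem_errorWords {x : ℕ → ℕ} {L : ℕ} :
    takeSeq (blockSeq x) L ∈ errorWords ↔
      ∃ k ≥ 1, x (k + 1) / 2 ≠ x k ∧ L = blockStart x (k + 2) := by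
  constructor
  · rintro ⟨y, k, hk, hne, h⟩
    obtain ⟨rfl, h⟩ := takeSeq_inj.1 h
    have hxy := eq_of_blockSeq_agree fun j hj => (h j hj).symm
    exact ⟨k, hk, by rwa [← hxy (k + 1) (by omega), ← hxy k (by omega)], blockStart_congr hxy⟩
  · rintro ⟨k, hk, hne, rfl⟩
    exact ⟨x, k, hk, hne, rfl⟩

theorem errorFree_blockSeq {x : ℕ → ℕ} :
    ErrorFree (blockSeq x) ↔ ∀ l ≥ 1, x (l + 1) / 2 = x l := by
  simp only [ErrorFree, takeSeq_blockSeq_mem_errorWords]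
  constructor
  · intro h l hl
    by_contra hne
    exact h _ ⟨l, hl, hne, rfl⟩
  · rintro h L ⟨k, hk, hne, -⟩
    exact hne (h k hk)

variable {F : Set (Cantor × (ℕ → ℕ))}

/-- A step word read along a consistent block sequence. -/
theorem exists_of_mem_stepWords {a i q L : ℕ} {α : Cantor} (hq : q + a = node α i)
    (hL : takeSeq (blockSeq (nodeBlocks a i α)) L ∈ stepWords F) :
    ∃ (α' : Cantor) (β : ℕ → ℕ) (m k : ℕ), (α', β) ∈ F ∧ 1 ≤ k ∧ code β m = q ∧
      (∀ j < i + k, α' j = α j) ∧ code β (m + 1) ≤ node α (i + k + 1) ∧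
      dropSeq (blockSeq (nodeBlocks a i α)) L =
        blockSeq (nodeBlocks (node α (i + k + 1) - code β (m + 1)) (i + k + 1) α) := by
  obtain ⟨α', β, m, i', a', k, hF, hk, hm, hle, h⟩ := hL
  obtain ⟨rfl, h⟩ := takeSeq_inj.1 h
  have hlt : ∀ j < blockStart (nodeBlocks a' i' α') (k + 1) + code β (m + 1),
      blockSeq (nodeBlocks a' i' α') j = blockSeq (nodeBlocks a i α) j := fun j hj => (h j hj).symm
  have heq := eq_of_blockSeq_agree (n := k + 1) fun j hj => hlt j (by omega)
  have hstart := blockStart_congr heq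
  have h0 : a' = a := heq 0 (by omega)
  have hi : i' = i := by
    have := (node_inj (heq 1 (by omega))).1
    omega
  subst h0 hi
  obtain ⟨k, rfl⟩ := Nat.exists_eq_add_of_le' hk
  have hagree : ∀ j < i' + (k + 1), α' j = α j := (node_inj (heq (k + 1) (by omega))).2
  have hle' : code β (m + 1) ≤ node α (i' + (k + 1) + 1) := by
    by_contra! hgt
    have : nodeBlocks a' i' α' (k + 1 + 1) ≤ nodeBlocks a' i' α (k + 1 + 1) := by
      refine block_le_of_agree hstart.symm ?_
      rw [hlt, blockSeq_one_at]
      rw [hstart]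
      exact Nat.add_lt_add_left hgt _
    exact absurd (hle.trans this) (not_le.2 hgt)
  refine ⟨α', β, m, k + 1, hF, hk, ?_, hagree, hle', ?_⟩
  · have := node_congr (n := i') fun j hj => hagree j (by omega)
    omega
  · rw [hstart, dropSeq_blockSeq (x := nodeBlocks a' i' α) hle', dropBlocks_nodeBlocks]

/-- The points of the projection of `F` having a witness extending the sequence coded by `q`. -/
def runSet (F : Set (Cantor × (ℕ → ℕ))) (q : ℕ) : Set Cantor :=
  {α | ∃ β m, code β m = q ∧ (α, β) ∈ F}

theorem blockSeq_nodeBlocks_mem_omegaPower {a i q : ℕ} {α : Cantor} (hq : q + a = node α i)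
    (hα : α ∈ runSet F q) : blockSeq (nodeBlocks a i α) ∈ omegaPower (stepWords F) := by
  refine mem_omegaPower_of_forall (P := {z | ∃ a i q, q + a = node α i ∧ α ∈ runSet F q ∧
    z = blockSeq (nodeBlocks a i α)}) ?_ ⟨a, i, q, hq, hα, rfl⟩
  rintro z ⟨a, i, q, hq, ⟨β, m, rfl, hF⟩, rfl⟩
  let k := code β (m + 1)
  have hle : code β (m + 1) ≤ node α (i + (k + 1) + 1) := by
    have := lt_node α (i + (k + 1) + 1)
    omega
  refine ⟨blockStart (nodeBlocks a i α) (k + 1 + 1) + code β (m + 1), by simp [blockStart],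
    ⟨α, β, m, i, a, k + 1, hF, by omega, hq, hle, rfl⟩, _, _, code β (m + 1),
    Nat.add_sub_of_le hle, ⟨β, m + 1, rfl, hF⟩, ?_⟩
  rw [dropSeq_blockSeq (x := nodeBlocks a i α) hle, dropBlocks_nodeBlocks]

theorem nil_notMem_stepWords : [] ∉ stepWords F := by
  rintro ⟨α, β, m, i, a, k, -, -, -, -, h⟩
  have := congrArg List.length h
  simp only [List.length_nil, length_takeSeq, blockStart] at this
  omega

theorem nil_notMem_errorWords : [] ∉ errorWords := by
  rintro ⟨x, k, -, -, h⟩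
  simpa [blockStart] using congrArg List.length h

theorem mem_runSet_of_mem_omegaPower (hF : IsClosed F) {a i q : ℕ} {α : Cantor}
    (hq : q + a = node α i) (hz : blockSeq (nodeBlocks a i α) ∈ omegaPower (stepWords F)) :
    α ∈ runSet F q := by
  let P : Set (ℕ × ℕ) := {s | ∃ a, s.2 + a = node α s.1 ∧
    blockSeq (nodeBlocks a s.1 α) ∈ omegaPower (stepWords F)}
  have hstep : ∀ s ∈ P, ∃ (α' : Cantor) (β : ℕ → ℕ) (m i : ℕ), (α', β) ∈ F ∧ code β m = s.2 ∧
      (∀ j < s.1, α' j = α j) ∧ s.1 < i ∧ (i, code β (m + 1)) ∈ P := by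
    rintro ⟨i, q⟩ ⟨a, hq, hz⟩
    obtain ⟨L, -, hL, hdrop⟩ := exists_takeSeq_mem nil_notMem_stepWords hz
    obtain ⟨α', β, m, k, hmem, -, hm, hagree, hle, h⟩ := exists_of_mem_stepWords hq hL
    rw [h] at hdrop
    exact ⟨α', β, m, i + k + 1, hmem, hm, fun j hj => hagree j (hj.trans_le (Nat.le_add_right _ _)),
      by simp only; omega, _, Nat.add_sub_of_le hle, hdrop⟩
  choose! u b m v hmem hcode hagree hlt hP using hstep
  let s : ℕ → ℕ × ℕ := fun n => Nat.rec (i, q) (fun _ s => (v s, code (b s) (m s + 1))) n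
  have hs : ∀ n, s n ∈ P := by
    intro n
    induction n with
    | zero => exact ⟨a, hq, hz⟩
    | succ n ih => exact hP _ ih
  have hn : ∀ n, n ≤ (s n).1 := by
    intro n
    induction n with
    | zero => simp
    | succ n ih => exact ih.trans_lt (hlt _ (hs n))
  have hsucc : ∀ n, m (s n) + 1 = m (s (n + 1)) ∧
      ∀ j < m (s n) + 1, b (s n) j = b (s (n + 1)) j := fun n =>
    code_inj (hcode _ (hs (n + 1))).symm
  have hm : ∀ n, m (s n) = m (s 0) + n := by
    intro n
    induction n with
    | zero => rfl
    | succ n ih => rw [← (hsucc n).1, ih, add_assoc]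
  have hb : ∀ n d j, j ≤ m (s 0) + n → b (s (n + d)) j = b (s n) j := by
    intro n d j hj
    induction d with
    | zero => rfl
    | succ d ih =>
      rw [← add_assoc, ← (hsucc (n + d)).2 j (by rw [hm]; omega), ih]
  refine ⟨fun j => b (s j) j, m (s 0), ?_, ?_⟩
  · rw [← show code (b (s 0)) (m (s 0)) = q from hcode _ (hs 0)]
    refine code_congr fun j hj => ?_
    simpa using hb 0 j j (by omega)
  · refine hF.mem_of_tendsto (f := fun n => (u (s n), b (s n))) (b := Filter.atTop)
      (Filter.Tendsto.prodMk_nhds (tendsto_pi_nhds.2 fun j => ?_) (tendsto_pi_nhds.2 fun j => ?_))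
      (Filter.Eventually.of_forall fun n => hmem _ (hs n))
    · refine tendsto_const_nhds.congr' ?_
      filter_upwards [Filter.eventually_gt_atTop j] with n hj
      exact (hagree _ (hs n) j (hj.trans_le (hn n))).symm
    · refine tendsto_const_nhds.congr' ?_
      filter_upwards [Filter.eventually_ge_atTop j] with n hj
      obtain ⟨d, rfl⟩ := Nat.exists_eq_add_of_le hj
      exact (hb j d j (by omega)).symm

theorem runSet_mem_piZero {ξ : Ordinal.{0}} {B : Set Cantor}
    (hF : IsClosedCover (PiZero Cantor ξ) B F) (hξ : 1 ≤ ξ) (q : ℕ) :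
    runSet F q ∈ PiZero Cantor ξ := by
  by_cases h : ∃ t m, code t m = q
  · obtain ⟨t, m, rfl⟩ := h
    convert hF.proj_mem {k | k < m} t using 1
    ext α
    constructor
    · rintro ⟨β, m', hm, hF⟩
      obtain ⟨rfl, h⟩ := code_inj hm
      exact ⟨β, h, hF⟩
    · rintro ⟨β, h, hF⟩
      exact ⟨β, m, code_congr h, hF⟩
  · convert empty_mem_piZero hξ
    refine Set.eq_empty_of_forall_notMem ?_
    rintro α ⟨β, m, hm, -⟩
    exact h ⟨β, m, hm⟩

theorem runSet_zero {Γ : Set (Set Cantor)} {B : Set Cantor} (hF : IsClosedCover Γ B F) :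
    runSet F 0 = B := by
  ext α
  rw [hF.mem_iff]
  exact ⟨fun ⟨β, _, _, h⟩ => ⟨β, h⟩, fun ⟨β, h⟩ => ⟨β, 0, rfl, h⟩⟩

theorem takeSeq_dropSeq_blockSeq_mem_errorWords {x : ℕ → ℕ} {p L : ℕ} :
    takeSeq (dropSeq (blockSeq x) p) L ∈ errorWords ↔
      ∃ j, p < blockStart x j ∧ x (j + 1) / 2 ≠ x j ∧ p + L = blockStart x (j + 2) := by
  obtain ⟨n, o, ho, rfl⟩ := exists_block x p
  rw [dropSeq_blockSeq ho, takeSeq_blockSeq_mem_errorWords]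
  have hpos : ∀ k, n + 1 ≤ k ↔ blockStart x n + o < blockStart x k := fun k => by
    constructor
    · intro h
      have h1 := (strictMono_blockStart x).monotone h
      have h2 : blockStart x (n + 1) = blockStart x n + x n + 1 := rfl
      omega
    · intro h
      exact (strictMono_blockStart x).lt_iff_lt.1 ((Nat.le_add_right _ _).trans_lt h)
  constructor
  · rintro ⟨k, hk, hne, rfl⟩
    obtain ⟨k, rfl⟩ := Nat.exists_eq_add_of_le' hk
    refine ⟨n + (k + 1), (hpos _).1 (by omega), hne, ?_⟩
    rw [add_comm]
    exact blockStart_dropBlocks ho (k + 2)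
  · rintro ⟨j, hj, hne, hL⟩
    obtain ⟨k, rfl⟩ := Nat.exists_eq_add_of_le ((hpos j).2 hj)
    refine ⟨k + 1, by omega, ?_, ?_⟩
    · convert hne using 2
      · simp only [dropBlocks, consSeq]
        ring_nf
      · simp only [dropBlocks, consSeq]
        ring_nf
    · have := blockStart_dropBlocks ho (k + 2)
      rw [show n + (k + 2) + 1 = n + 1 + k + 2 by ring, ← hL] at this
      change L = blockStart (dropBlocks x n o) (k + 2 + 1)
      omega

theorem ErrorFree.dropSeq {x : ℕ → ℕ} (h : ErrorFree (blockSeq x)) (p : ℕ) :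
    ErrorFree (dropSeq (blockSeq x) p) := by
  intro L hL
  obtain ⟨j, hj, hne, hL⟩ := takeSeq_dropSeq_blockSeq_mem_errorWords.1 hL
  refine h (p + L) ?_
  rw [← dropSeq_zero (blockSeq x)]
  exact takeSeq_dropSeq_blockSeq_mem_errorWords.2
    ⟨j, (Nat.zero_le p).trans_lt hj, hne, by rwa [zero_add]⟩

/-- A step word does not start with an error word. -/
theorem takeSeq_notMem_errorWords {z : Cantor} {L L' : ℕ} (h : takeSeq z L ∈ stepWords F)
    (hL : L' ≤ L) : takeSeq z L' ∉ errorWords := by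
  obtain ⟨α, β, m, i, a, k, -, -, -, -, h⟩ := h
  obtain ⟨rfl, h⟩ := takeSeq_inj.1 h
  rw [takeSeq_inj.2 ⟨rfl, fun k hk => h k (hk.trans_le hL)⟩]
  exact errorFree_blockSeq.2 (fun l hl => nodeBlocks_succ_div_two hl) _

theorem nil_notMem_union : [] ∉ stepWords F ∪ errorWords :=
  fun h => h.elim nil_notMem_stepWords nil_notMem_errorWords

theorem exists_one_of_takeSeq_mem {z : Cantor} {L : ℕ}
    (h : takeSeq z L ∈ stepWords F ∪ errorWords) : ∃ k, z k = 1 := by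
  have key : ∀ (x : ℕ → ℕ) (n r : ℕ),
      takeSeq z L = takeSeq (blockSeq x) (blockStart x (n + 1) + r) → ∃ k, z k = 1 := by
    intro x n r h
    obtain ⟨rfl, h⟩ := takeSeq_inj.1 h
    refine ⟨blockStart x n + x n, ?_⟩
    rw [h _ (by simp only [blockStart]; omega), blockSeq_one_at]
  rcases h with ⟨α, β, m, i, a, k, -, -, -, -, h⟩ | ⟨x, k, -, -, h⟩
  · exact key _ _ _ h
  · exact key x (k + 1) 0 h

theorem exists_eq_blockSeq_of_mem_omegaPower {z : Cantor}
    (hz : z ∈ omegaPower (stepWords F ∪ errorWords)) : ∃ x, z = blockSeq x := by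
  refine exists_eq_blockSeq fun N => ?_
  induction N generalizing z with
  | zero =>
    obtain ⟨L, -, hL, -⟩ := exists_takeSeq_mem nil_notMem_union hz
    obtain ⟨k, hk⟩ := exists_one_of_takeSeq_mem hL
    exact ⟨k, Nat.zero_le k, hk⟩
  | succ N ih =>
    obtain ⟨L, hL, -, hz⟩ := exists_takeSeq_mem nil_notMem_union hz
    obtain ⟨k, hk, h1⟩ := ih hz
    exact ⟨L + k, by omega, h1⟩

/-- The sequences which are parsed by step words describing successful runs. -/
def tailSet (F : Set (Cantor × (ℕ → ℕ))) : Set Cantor :=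
  {z | ∃ a i q α, q + a = node α i ∧ α ∈ runSet F q ∧ z = blockSeq (nodeBlocks a i α)}

theorem tailSet_subset_omegaPower : tailSet F ⊆ omegaPower (stepWords F ∪ errorWords) := by
  rintro z ⟨a, i, q, α, hq, hα, rfl⟩
  exact omegaPower_mono nil_notMem_stepWords Set.subset_union_left
    (blockSeq_nodeBlocks_mem_omegaPower hq hα)

theorem ErrorFree.mem_omegaPower_stepWords {z : Cantor} (he : ErrorFree z)
    (hz : z ∈ omegaPower (stepWords F ∪ errorWords)) : z ∈ omegaPower (stepWords F) := by
  refine mem_omegaPower_of_forall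
    (P := {z | ErrorFree z ∧ z ∈ omegaPower (stepWords F ∪ errorWords)}) ?_ ⟨he, hz⟩
  rintro z ⟨he, hz⟩
  obtain ⟨L, hL, hmem, hdrop⟩ := exists_takeSeq_mem nil_notMem_union hz
  obtain ⟨x, rfl⟩ := exists_eq_blockSeq_of_mem_omegaPower hz
  exact ⟨L, hL, hmem.resolve_right (he L), he.dropSeq L, hdrop⟩

theorem ErrorFree.mem_tailSet (hF : IsClosed F) {z : Cantor} (he : ErrorFree z)
    (hz : z ∈ omegaPower (stepWords F ∪ errorWords)) : z ∈ tailSet F := by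
  have hstep := he.mem_omegaPower_stepWords hz
  obtain ⟨x, rfl⟩ := exists_eq_blockSeq_of_mem_omegaPower hz
  obtain ⟨L, -, ⟨α, β, m, i, a, k, -, hk, hm, -, h⟩, -⟩ :=
    exists_takeSeq_mem nil_notMem_stepWords hstep
  obtain ⟨rfl, h⟩ := takeSeq_inj.1 h
  have hx := eq_of_blockSeq_agree (n := k + 1) (x := nodeBlocks a i α) (y := x)
    fun j hj => (h j (by omega)).symm
  have h0 : a = x 0 := hx 0 (by omega)
  obtain ⟨α', hx', hnode⟩ :=
    exists_eq_nodeBlocks (errorFree_blockSeq.1 he) (hx 1 (by omega)).symm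
  have hq : code β m + x 0 = node α' i := by omega
  rw [hx'] at hstep ⊢
  exact ⟨_, i, _, α', hq, mem_runSet_of_mem_omegaPower hF hq hstep, rfl⟩

/-- The sequences in which all the error words occur before the position `L`. -/
def boundedErrors (L : ℕ) : Set Cantor :=
  {z | ∀ p l, L < p + l → takeSeq (dropSeq z p) l ∉ errorWords}

theorem mem_omegaPower_of_notMem_boundedErrors {z : Cantor} (h : ∀ L, z ∉ boundedErrors L) :
    z ∈ omegaPower (stepWords F ∪ errorWords) := by
  simp only [boundedErrors, Set.mem_ofPred_eq, not_forall, not_not] at h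
  obtain ⟨x, rfl⟩ : ∃ x, z = blockSeq x := by
    refine exists_eq_blockSeq fun N => ?_
    obtain ⟨p, l, hl, x, k, -, -, hmem⟩ := h N
    obtain ⟨rfl, hx⟩ := takeSeq_inj.1 hmem
    have hb : blockStart x (k + 2) = blockStart x (k + 1) + x (k + 1) + 1 := rfl
    refine ⟨p + (blockStart x (k + 1) + x (k + 1)), by omega, ?_⟩
    have := hx (blockStart x (k + 1) + x (k + 1)) (by omega)
    rwa [blockSeq_one_at] at this
  refine mem_omegaPower_of_forall (P := {w | ∃ p, w = dropSeq (blockSeq x) p}) ?_ ⟨0, by simp⟩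
  rintro w ⟨p, rfl⟩
  obtain ⟨p', l, hl, herr⟩ := h (blockStart x (p + 2))
  obtain ⟨j, -, hne, hj⟩ := takeSeq_dropSeq_blockSeq_mem_errorWords.1 herr
  have hpj : p + 2 < j + 2 := (strictMono_blockStart x).lt_iff_lt.1 (hj ▸ hl)
  have hj1 := (strictMono_blockStart x).le_apply (x := j)
  have hj2 := strictMono_blockStart x (show j < j + 2 by omega)
  exact ⟨blockStart x (j + 2) - p, by omega,
    .inr (takeSeq_dropSeq_blockSeq_mem_errorWords.2 ⟨j, by omega, hne, by omega⟩), _,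
    dropSeq_dropSeq _ _ _⟩

theorem mem_omegaPower_iff_of_mem_boundedErrors (hF : IsClosed F) {z : Cantor} {L : ℕ}
    (hz : z ∈ boundedErrors L) : z ∈ omegaPower (stepWords F ∪ errorWords) ↔
      ∃ p ≤ L, Reachable (stepWords F ∪ errorWords) z p ∧ dropSeq z p ∈ tailSet F := by
  constructor
  · intro h
    obtain ⟨p, hp, l, hl, hreach, hmem, hdrop⟩ := exists_reachable_le nil_notMem_union h L
    refine ⟨p, hp, hreach, ErrorFree.mem_tailSet hF (fun l' => ?_) hdrop⟩
    rcases lt_or_ge L (p + l') with hl' | hl'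
    · exact hz p l' hl'
    · exact takeSeq_notMem_errorWords (hmem.resolve_right (hz p l hl)) (by omega)
  · rintro ⟨p, -, hreach, htail⟩
    exact hreach.mem_omegaPower nil_notMem_union (tailSet_subset_omegaPower htail)

/-! ### The Borel class of the ω-power -/

theorem isClopen_of_finite_dependence {s : Set Cantor} (N : ℕ)
    (h : ∀ z z' : Cantor, (∀ k < N, z k = z' k) → z ∈ s → z' ∈ s) : IsClopen s := by
  have key : ∀ t : Set Cantor, (∀ z z' : Cantor, (∀ k < N, z k = z' k) → z ∈ t → z' ∈ t) →
      IsOpen t := by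
    intro t ht
    refine isOpen_iff_mem_nhds.2 fun z hz => ?_
    have hopen : IsOpen (⋂ k ∈ Finset.range N, (fun z' : Cantor => z' k) ⁻¹' {z k}) :=
      isOpen_biInter_finset fun k _ => (isOpen_discrete {z k}).preimage (continuous_apply k)
    refine Filter.mem_of_superset (hopen.mem_nhds (by simp)) fun z' hz' => ht z z' ?_ hz
    intro k hk
    simp only [Finset.mem_range, Set.mem_iInter] at hz'
    exact (show z' k = z k from hz' k hk).symm
  exact ⟨isOpen_compl_iff.1 (key _ fun z z' hzz' hz hz' =>
    hz (h z' z (fun k hk => (hzz' k hk).symm) hz')), key s h⟩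

theorem continuous_blockSeq_nodeBlocks (a i : ℕ) :
    Continuous fun α : Cantor => blockSeq (nodeBlocks a i α) := by
  refine continuous_pi fun k => continuous_def.2 fun s _ => ?_
  have key : ∀ α α' : Cantor, (∀ j < i + k + 1, α j = α' j) →
      blockSeq (nodeBlocks a i α) k = 1 → blockSeq (nodeBlocks a i α') k = 1 := by
    intro α α' h h1
    obtain ⟨n, hn⟩ := blockSeq_eq_one.1 h1
    have hnk := (strictMono_blockStart (nodeBlocks a i α)).le_apply (x := n + 1)
    refine blockSeq_eq_one.2 ⟨n, hn.trans (blockStart_congr fun l hl => ?_)⟩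
    rcases l with _ | l
    · rfl
    · exact node_congr fun j hj => h j (by omega)
  refine (isClopen_of_finite_dependence (i + k + 1) fun α α' h hα => ?_).isOpen
  have heq : blockSeq (nodeBlocks a i α) k = blockSeq (nodeBlocks a i α') k := by
    have h1 := key α α' h
    have h2 := key α' α fun j hj => (h j hj).symm
    omega
  simpa only [Set.mem_preimage, ← heq] using hα

theorem isClosedEmbedding_blockSeq_nodeBlocks (a i : ℕ) :
    IsClosedEmbedding fun α : Cantor => blockSeq (nodeBlocks a i α) := by
  refine (continuous_blockSeq_nodeBlocks a i).isClosedEmbedding fun α α' h => ?_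
  have h := blockSeq_injective h
  funext j
  exact (node_inj (congrFun h (j + 1))).2 j (by omega)

theorem continuous_dropSeq (p : ℕ) : Continuous fun z : Cantor => dropSeq z p :=
  continuous_pi fun k => continuous_apply (p + k)

theorem isClopen_reachable (A : Set (List (Fin 2))) (p : ℕ) :
    IsClopen {z : Cantor | Reachable A z p} :=
  isClopen_of_finite_dependence p fun _ _ h hz => hz.congr h

theorem isClosed_boundedErrors (L : ℕ) : IsClosed (boundedErrors L) := by
  simp only [boundedErrors, Set.ofPred_forall]
  refine isClosed_iInter fun p => isClosed_iInter fun l => isClosed_iInter fun _ =>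
    (isClopen_of_finite_dependence (p + l) fun z z' h hz => ?_).isClosed
  have : takeSeq (dropSeq z p) l = takeSeq (dropSeq z' p) l :=
    takeSeq_inj.2 ⟨rfl, fun k hk => h (p + k) (by omega)⟩
  simpa only [Set.mem_ofPred_eq, ← this] using hz

theorem tailSet_mem_piZero {ξ : Ordinal.{0}} (hξ : 1 < ξ)
    (hF : ∀ q, runSet F q ∈ PiZero Cantor ξ) : tailSet F ∈ PiZero Cantor ξ := by
  let T : ℕ → ℕ → ℕ → Set Cantor := fun a i q =>
    (fun α : Cantor => blockSeq (nodeBlocks a i α)) '' ({α | q + a = node α i} ∩ runSet F q)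
  have hT : ∀ a i q, T a i q ∈ PiZero Cantor ξ := fun a i q => by
    refine image_mem_piZero (isClosedEmbedding_blockSeq_nodeBlocks a i) hξ.le
      (inter_mem_piZero hξ.le (IsClosed.mem_piZero hξ.le ?_) (hF q))
    refine (isClopen_of_finite_dependence i fun α α' h hα => ?_).isClosed
    simpa only [Set.mem_ofPred_eq, node_congr h] using hα
  let E : ℕ → ℕ → Set Cantor := fun u v => {z | z u = 1 ∧ z v = 1}
  have hE : ∀ u v, IsClopen (E u v) := fun u v =>
    isClopen_of_finite_dependence (u + v + 1) fun z z' h hz =>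
      ⟨(h u (by omega)).symm.trans hz.1, (h v (by omega)).symm.trans hz.2⟩
  have hTE : ∀ a i q, ∀ z ∈ T a i q, ∃ u v, u < v ∧ z ∈ E u v := by
    rintro a i q z ⟨α, -, rfl⟩
    exact ⟨_, _, by simp [blockStart]; omega, blockSeq_one_at _ 0, blockSeq_one_at _ 1⟩
  have hbound : ∀ a i q, ∀ z ∈ T a i q, ∀ u v, u < v → z ∈ E u v → a ≤ v ∧ i ≤ v ∧ q ≤ v := by
    rintro a i q z ⟨α, ⟨hq : q + a = node α i, -⟩, rfl⟩ u v huv ⟨hu, hv⟩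
    obtain ⟨n, hn⟩ := blockSeq_eq_one.1 hu
    obtain ⟨n', hn'⟩ := blockSeq_eq_one.1 hv
    have hlt : n + 1 < n' + 1 := (strictMono_blockStart (nodeBlocks a i α)).lt_iff_lt.1 (by omega)
    have hle := (strictMono_blockStart (nodeBlocks a i α)).monotone (show 2 ≤ n' + 1 by omega)
    have h2 : blockStart (nodeBlocks a i α) 2 = 0 + a + 1 + (2 * node α i + (α i).val) + 1 := rfl
    have := lt_node α i
    omega
  have hcompl : (tailSet F)ᶜ = (⋃ w : {w : ℕ × ℕ // w.1 < w.2}, E w.1.1 w.1.2 ∩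
      ⋂ t ∈ Finset.range (w.1.2 + 1) ×ˢ Finset.range (w.1.2 + 1) ×ˢ Finset.range (w.1.2 + 1),
        (T t.1 t.2.1 t.2.2)ᶜ) ∪ ⋂ w : {w : ℕ × ℕ // w.1 < w.2}, (E w.1.1 w.1.2)ᶜ := by
    have hmem : ∀ z, z ∈ tailSet F ↔ ∃ a i q, z ∈ T a i q := fun z =>
      ⟨fun ⟨a, i, q, α, hq, hα, h⟩ => ⟨a, i, q, α, ⟨hq, hα⟩, h.symm⟩,
        fun ⟨a, i, q, α, ⟨hq, hα⟩, h⟩ => ⟨a, i, q, α, hq, hα, h.symm⟩⟩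
    ext z
    simp only [Set.mem_compl_iff, hmem, Set.mem_union, Set.mem_iUnion, Set.mem_inter_iff,
      Set.mem_iInter, Finset.mem_product, Finset.mem_range, Subtype.exists, Subtype.forall,
      Prod.exists, Prod.forall, exists_prop, not_exists]
    constructor
    · intro h
      by_cases hz : ∃ u v, u < v ∧ z ∈ E u v
      · obtain ⟨u, v, huv, hz⟩ := hz
        exact .inl ⟨u, v, huv, hz, fun a i q _ => h a i q⟩
      · exact .inr fun u v huv hz' => hz ⟨u, v, huv, hz'⟩
    · rintro (⟨u, v, huv, hz, h⟩ | h) a i q hmem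
      · have := hbound a i q z hmem u v huv hz
        exact h a i q ⟨by omega, by omega, by omega⟩ hmem
      · obtain ⟨u, v, huv, hz⟩ := hTE a i q z hmem
        exact h u v huv hz
  rw [mem_piZero_iff, hcompl]
  refine union_mem_sigmaZero hξ.le (iUnion_mem_sigmaZero hξ.le fun w => inter_mem_sigmaZero hξ.le
    ((hE _ _).isOpen.mem_sigmaZero hξ.le) (biInter_finset_mem_sigmaZero hξ.le _ fun t _ => ?_))
    (IsClosed.mem_sigmaZero hξ (isClosed_iInter fun w => (hE _ _).compl.isClosed))
  exact mem_piZero_iff.1 (hT _ _ _)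

theorem omegaPower_mem_piZero {ξ : Ordinal.{0}} (hξ : 1 < ξ) (hF : IsClosed F)
    (htail : tailSet F ∈ PiZero Cantor ξ) :
    omegaPower (stepWords F ∪ errorWords) ∈ PiZero Cantor ξ := by
  have hcompl : (omegaPower (stepWords F ∪ errorWords))ᶜ = ⋃ L, boundedErrors L ∩
      ⋂ p ∈ Finset.range (L + 1), ({z | Reachable (stepWords F ∪ errorWords) z p}ᶜ ∪
        (fun z => dropSeq z p) ⁻¹' (tailSet F)ᶜ) := by
    ext z
    simp only [Set.mem_compl_iff, Set.mem_iUnion, Set.mem_inter_iff, Set.mem_iInter,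
      Finset.mem_range, Order.lt_add_one_iff, Set.mem_union, Set.mem_ofPred_eq, Set.mem_preimage,
      ← not_and_or]
    have h : ∀ L, z ∈ boundedErrors L → (z ∉ omegaPower (stepWords F ∪ errorWords) ↔
        ∀ p ≤ L, ¬(Reachable (stepWords F ∪ errorWords) z p ∧ dropSeq z p ∈ tailSet F)) :=
      fun L hL => by simp [mem_omegaPower_iff_of_mem_boundedErrors hF hL]
    constructor
    · intro hz
      obtain ⟨L, hL⟩ : ∃ L, z ∈ boundedErrors L := by
        by_contra! hL
        exact hz (mem_omegaPower_of_notMem_boundedErrors hL)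
      exact ⟨L, hL, (h L hL).1 hz⟩
    · rintro ⟨L, hL, hz⟩
      exact (h L hL).2 hz
  rw [mem_piZero_iff, hcompl]
  refine iUnion_mem_sigmaZero hξ.le fun L => inter_mem_sigmaZero hξ.le
    ((isClosed_boundedErrors L).mem_sigmaZero hξ) (biInter_finset_mem_sigmaZero hξ.le _ fun p _ =>
      union_mem_sigmaZero hξ.le ((isClopen_reachable _ p).compl.isOpen.mem_sigmaZero hξ.le)
        (preimage_mem_sigmaZero (continuous_dropSeq p) hξ.le (mem_piZero_iff.1 htail)))

theorem blockSeq_mem_omegaPower_iff (hF : IsClosed F) (α : Cantor) :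
    blockSeq (nodeBlocks 1 0 α) ∈ omegaPower (stepWords F ∪ errorWords) ↔ α ∈ runSet F 0 := by
  constructor
  · intro h
    exact mem_runSet_of_mem_omegaPower hF rfl (ErrorFree.mem_omegaPower_stepWords
      (errorFree_blockSeq.2 fun l hl => nodeBlocks_succ_div_two hl) h)
  · intro h
    exact tailSet_subset_omegaPower ⟨1, 0, 0, α, rfl, h, rfl⟩

/-- Hardness for `Π⁰_ξ` is transferred by a continuous reduction. -/
theorem hard_of_preimage_eq {ξ : Ordinal.{0}} (hξ : 1 ≤ ξ) {B C : Set Cantor}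
    (hB : ParamComplete ξ B) {g : Cantor → Cantor} (hg : Continuous g) (hBC : g ⁻¹' C = B) :
    (∀ (X : Type) [TopologicalSpace X] [PolishSpace X], ZeroDim X →
      ∀ S ∈ PiZero X ξ, ∃ f : X → Cantor, Continuous f ∧ S = f ⁻¹' C) ∧ C ∉ SigmaZero Cantor ξ := by
  constructor
  · intro X _ _ hX S hS
    obtain ⟨f, hf, rfl⟩ := hB.exists_reduction hX hS
    exact ⟨g ∘ f, hg.comp hf, by rw [Set.preimage_comp, hBC]⟩
  · intro hC
    exact hB.notMem_sigmaZero hξ (hBC ▸ preimage_mem_sigmaZero hg hξ hC)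

theorem omegaPower_singleton_zero : omegaPower {[(0 : Fin 2)]} = ({0} : Set Cantor) := by
  have hnil : ([] : List (Fin 2)) ∉ ({[0]} : Set (List (Fin 2))) := by simp
  ext z
  constructor
  · intro hz
    have : ∀ k, ∀ z : Cantor, z ∈ omegaPower {[(0 : Fin 2)]} → z k = 0 := by
      intro k
      induction k with
      | zero =>
        intro z hz
        obtain ⟨L, -, hL, -⟩ := exists_takeSeq_mem hnil hz
        obtain rfl : L = 1 := by simpa using congrArg List.length (Set.mem_singleton_iff.1 hL)
        simpa [takeSeq] using hL
      | succ k ih =>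
        intro z hz
        obtain ⟨L, -, hL, hdrop⟩ := exists_takeSeq_mem hnil hz
        obtain rfl : L = 1 := by simpa using congrArg List.length (Set.mem_singleton_iff.1 hL)
        simpa [dropSeq, add_comm] using ih _ hdrop
    exact funext fun k => this k z hz
  · rintro rfl
    refine mem_omegaPower_of_forall (P := {0}) ?_ rfl
    rintro _ rfl
    exact ⟨1, one_pos, by simp [takeSeq], rfl⟩

/-- For every countable ordinal ξ ≥ 1 there is a set A of finite binary words whose
ω-power is Π⁰_ξ-complete; in particular A^∞ ∈ Π⁰_ξ(2^ω) \ Σ⁰_ξ(2^ω). -/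
theorem pi_complete_omega_power (ξ : Ordinal.{0}) (hξ : 1 ≤ ξ)
    (hcount : ξ.card ≤ Cardinal.aleph0) :
    ∃ A : Set (List (Fin 2)),
      omegaPower A ∈ PiZero Cantor ξ ∧
      (∀ (X : Type) [TopologicalSpace X] [PolishSpace X], ZeroDim X →
        ∀ S ∈ PiZero X ξ, ∃ f : X → Cantor, Continuous f ∧ S = f ⁻¹' omegaPower A) ∧
      omegaPower A ∉ SigmaZero Cantor ξ := by
  rcases hξ.eq_or_lt with rfl | h
  · refine ⟨{[0]}, ?_, ?_⟩
    · rw [omegaPower_singleton_zero]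
      exact mem_piZero_one.2 isClosed_singleton
    · exact hard_of_preimage_eq hξ paramComplete_one continuous_id
        omegaPower_singleton_zero
  · obtain ⟨B, hB, hcomplete⟩ := exists_paramComplete ξ hξ hcount
    obtain ⟨F, hF⟩ := (exists_isClosedCover ξ hξ).2 B hB
    refine ⟨stepWords F ∪ errorWords, omegaPower_mem_piZero h hF.isClosed
      (tailSet_mem_piZero h (runSet_mem_piZero hF hξ)), hard_of_preimage_eq hξ hcomplete
        (continuous_blockSeq_nodeBlocks 1 0) ?_⟩
    ext α
    rw [Set.mem_preimage, blockSeq_mem_omegaPower_iff hF.isClosed, runSet_zero hF]
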